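/- Let p, q, m, n be positive integers with m + n ≤ p and m + n ≤ q, and let X ∈ M_{m,n}(ℂ), Y ∈ M_{n,m}(ℂ) be arbitrary complex matrices. In the polynomial ring over ℂ in the variables a_{k,i} (1 ≤ k ≤ p, 1 ≤ i ≤ m), b_{k,j} (1 ≤ k ≤ p, 1 ≤ j ≤ n), c_{l,i} (1 ≤ l ≤ q, 1 ≤ i ≤ m), d_{l,j} (1 ≤ l ≤ q, 1 ≤ j ≤ n), let I be the ideal generated by the polynomials ∑_{k=1}^p a_{k,i} b_{k,j} − X_{i,j} for 1 ≤ i ≤ m, 1 ≤ j ≤ n, together with the polynomials ∑_{l=1}^q d_{l,i} c_{l,j} − Y_{i,j} for 1 ≤ i ≤ n, 1 ≤ j ≤ m. Then the quotient of the polynomial ring by I is an integral domain. (That is, the scheme-theoretic fiber of the moment map ψ(A,B,C,D) = (AᵀB, DᵀC) over the point (X,Y) is reduced and irreducible.) -/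

import Mathlib

open MvPolynomial

/-- The ideal of the scheme-theoretic fiber of the moment map
`ψ(A,B,C,D) = (AᵀB, DᵀC)` over the point `(X,Y)`, in the polynomial ring of the
matrix entries of `A ∈ M_{p,m}(ℂ)`, `B ∈ M_{p,n}(ℂ)`, `C ∈ M_{q,m}(ℂ)`,
`D ∈ M_{q,n}(ℂ)`. -/
noncomputable def momentFiberIdealUU (p q m n : ℕ)
    (Xm : Matrix (Fin m) (Fin n) ℂ) (Ym : Matrix (Fin n) (Fin m) ℂ) :
    Ideal (MvPolynomial
      (((Fin p × Fin m) ⊕ (Fin p × Fin n)) ⊕ ((Fin q × Fin m) ⊕ (Fin q × Fin n))) ℂ) :=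
  Ideal.span
    ({f | ∃ (i : Fin m) (j : Fin n),
        f = (∑ k : Fin p,
              X (Sum.inl (Sum.inl (k, i))) * X (Sum.inl (Sum.inr (k, j)))) -
            C (Xm i j)} ∪
     {f | ∃ (i : Fin n) (j : Fin m),
        f = (∑ l : Fin q,
              X (Sum.inr (Sum.inr (l, i))) * X (Sum.inr (Sum.inl (l, j)))) -
            C (Ym i j)})

/-- The ideal `J` is the ideal of top-degree forms of `I`, for the grading encoded by the
coaction `Φ : P →+* P[T]`. -/
structure IsLeadingIdeal {P : Type*} [CommRing P] (Φ : P →+* Polynomial P) (I J : Ideal P) :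
    Prop where
  coeff_mem : ∀ (d : ℕ) (f : P), f ∈ I → (Φ f).natDegree ≤ d → (Φ f).coeff d ∈ J
  lift : ∀ (d : ℕ) (g : P), g ∈ J →
    ∃ f ∈ I, (Φ f).natDegree ≤ d ∧ (Φ f).coeff d = (Φ g).coeff d

namespace IsLeadingIdeal

variable {P : Type*} [CommRing P] {Φ : P →+* Polynomial P} {I J : Ideal P}

theorem bot : IsLeadingIdeal Φ ⊥ ⊥ where
  coeff_mem d f hf _ := by simp [Ideal.mem_bot.1 hf]
  lift d g hg := ⟨0, by simp, by simp, by simp [Ideal.mem_bot.1 hg]⟩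

theorem eq_zero_of_degree_lt_zero (hΦ : ∀ f, (Φ f).eval 1 = f) {f : P}
    (hf : (Φ f).degree < (0 : ℕ)) : f = 0 := by
  have h : Φ f = 0 := by simpa using hf
  rw [← hΦ f, h, Polynomial.eval_zero]

theorem degree_sub_lt_of_coeff_eq {A : Type*} [CommRing A] {f g : Polynomial A} {d : ℕ}
    (hf : f.natDegree ≤ d) (hg : g.natDegree ≤ d) (h : f.coeff d = g.coeff d) :
    (f - g).degree < d := by
  rw [Polynomial.natDegree_le_iff_coeff_eq_zero] at hf hg
  rw [Polynomial.degree_lt_iff_coeff_zero]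
  intro k hk
  rcases hk.eq_or_lt with rfl | hk
  · simp [h]
  · simp [hf k hk, hg k hk]

theorem natDegree_le_of_degree_lt_succ {A : Type*} [CommRing A] {f : Polynomial A} {d : ℕ}
    (hf : f.degree < (d + 1 : ℕ)) : f.natDegree ≤ d := by
  rw [Polynomial.degree_lt_iff_coeff_zero] at hf
  rw [Polynomial.natDegree_le_iff_coeff_eq_zero]
  exact fun k hk => hf k hk

/-- Adjoining one generator whose leading form is a nonzerodivisor modulo `J`. -/
theorem sup_span_singleton (hΦ : ∀ f, (Φ f).eval 1 = f)
    (hcoeff : ∀ f d, Φ ((Φ f).coeff d) = Polynomial.monomial d ((Φ f).coeff d))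
    (h : IsLeadingIdeal Φ I J) (hJ : J.IsPrime) {E e : P} {δ : ℕ}
    (hE : (Φ E).natDegree ≤ δ) (hEe : (Φ E).coeff δ = e) (he : e ∉ J) :
    IsLeadingIdeal Φ (Ideal.span {E} ⊔ I) (Ideal.span {e} ⊔ J) where
  coeff_mem d f hf hfd := by
    obtain ⟨g, i, hi, hgi⟩ := Ideal.mem_span_singleton_sup.1 hf
    obtain ⟨D, hD⟩ : ∃ D : ℕ, (Φ g).degree < D := ⟨(Φ g).natDegree + 1, by
      exact lt_of_le_of_lt Polynomial.degree_le_natDegree (by exact_mod_cast Nat.lt_succ_self _)⟩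
    induction D generalizing g i with
    | zero =>
      have hg := eq_zero_of_degree_lt_zero hΦ hD
      subst hg
      refine Ideal.mem_sup_right (h.coeff_mem d f ?_ hfd)
      rw [← hgi]; simpa using hi
    | succ D ih =>
      have hgD := natDegree_le_of_degree_lt_succ hD
      have hgE : (Φ (g * E)).natDegree ≤ D + δ := by
        rw [map_mul]; exact Polynomial.natDegree_mul_le_of_le hgD hE
      by_cases hd : D + δ ≤ d
      · have hid : (Φ i).natDegree ≤ d := by
          have : i = f - g * E := by rw [← hgi]; ring
          rw [this, map_sub]
          exact Polynomial.natDegree_sub_le_of_le hfd (hgE.trans hd) |>.trans (by simp)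
        rw [← hgi, map_add, Polynomial.coeff_add]
        refine add_mem (Ideal.mem_sup_left ?_) (Ideal.mem_sup_right (h.coeff_mem d i hi hid))
        have h1 : (Φ g).natDegree ≤ d - δ := by omega
        have h2 : d = (d - δ) + δ := by omega
        rw [map_mul, h2, Polynomial.coeff_mul_add_eq_of_natDegree_le h1 hE, hEe]
        exact Ideal.mul_mem_left _ _ (Ideal.mem_span_singleton_self _)
      · have hi' : i = f - g * E := by rw [← hgi]; ring
        have hid : (Φ i).natDegree ≤ D + δ := by
          rw [hi', map_sub]
          exact (Polynomial.natDegree_sub_le_of_le (hfd.trans (not_le.1 hd).le) hgE).trans (by simp)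
        have hmem := h.coeff_mem _ i hi hid
        rw [hi', map_sub, Polynomial.coeff_sub,
          Polynomial.coeff_eq_zero_of_natDegree_lt (by omega : (Φ f).natDegree < D + δ), zero_sub,
          neg_mem_iff, map_mul, Polynomial.coeff_mul_add_eq_of_natDegree_le hgD hE, hEe] at hmem
        have hg := (hJ.mem_or_mem hmem).resolve_right he
        obtain ⟨g₁, hg₁, hg₁D, hg₁c⟩ := h.lift D _ hg
        rw [hcoeff, Polynomial.coeff_monomial, if_pos rfl] at hg₁c
        refine ih (g - g₁) (i + g₁ * E) (add_mem hi (Ideal.mul_mem_right _ _ hg₁))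
          (by rw [← hgi]; ring) ?_
        rw [map_sub]
        exact degree_sub_lt_of_coeff_eq hgD hg₁D hg₁c.symm
  lift d g hg := by
    obtain ⟨a, j, hj, rfl⟩ := Ideal.mem_span_singleton_sup.1 hg
    obtain ⟨i, hi, hid, hic⟩ := h.lift d j hj
    have hΦe : Φ e = Polynomial.monomial δ e := by rw [← hEe, hcoeff]
    by_cases hd : δ ≤ d
    · obtain ⟨k, rfl⟩ := Nat.exists_eq_add_of_le' hd
      have hk : (Φ ((Φ a).coeff k)).natDegree ≤ k := by
        rw [hcoeff]; exact Polynomial.natDegree_monomial_le _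
      refine ⟨(Φ a).coeff k * E + i, add_mem (Ideal.mem_sup_left
        (Ideal.mul_mem_left _ _ (Ideal.mem_span_singleton_self _))) (Ideal.mem_sup_right hi), ?_, ?_⟩
      · rw [map_add, map_mul]
        exact Polynomial.natDegree_add_le_of_degree_le
          (Polynomial.natDegree_mul_le_of_le hk hE) hid
      · rw [map_add, map_add, Polynomial.coeff_add, Polynomial.coeff_add, hic, map_mul, map_mul,
          Polynomial.coeff_mul_add_eq_of_natDegree_le hk hE, hcoeff, hEe, hΦe,
          Polynomial.coeff_mul_monomial, Polynomial.coeff_monomial, if_pos rfl]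
    · refine ⟨i, Ideal.mem_sup_right hi, hid, ?_⟩
      rw [hic, map_add, map_mul, hΦe, Polynomial.coeff_add, ← Polynomial.C_mul_X_pow_eq_monomial,
        ← mul_assoc, Polynomial.coeff_mul_X_pow', if_neg hd, zero_add]

theorem exists_sub_mem (hΦ : ∀ f, (Φ f).eval 1 = f)
    (hcoeff : ∀ f d, Φ ((Φ f).coeff d) = Polynomial.monomial d ((Φ f).coeff d))
    (h : IsLeadingIdeal Φ I J) {f : P} (hf : f ∉ I) :
    ∃ (f' : P) (d : ℕ), f - f' ∈ I ∧ (Φ f').natDegree ≤ d ∧ (Φ f').coeff d ∉ J := by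
  obtain ⟨D, hD⟩ : ∃ D : ℕ, (Φ f).degree < D := ⟨(Φ f).natDegree + 1, by
    exact lt_of_le_of_lt Polynomial.degree_le_natDegree (by exact_mod_cast Nat.lt_succ_self _)⟩
  induction D generalizing f with
  | zero =>
    rw [eq_zero_of_degree_lt_zero hΦ hD] at hf
    exact absurd (zero_mem _) hf
  | succ D ih =>
    have hfD := natDegree_le_of_degree_lt_succ hD
    by_cases hc : (Φ f).coeff D ∈ J
    · obtain ⟨i, hi, hiD, hic⟩ := h.lift D _ hc
      rw [hcoeff, Polynomial.coeff_monomial, if_pos rfl] at hic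
      have hfi : f - i ∉ I := fun H => hf (by simpa using add_mem H hi)
      obtain ⟨f', d, h1, h2, h3⟩ := ih hfi (by
        rw [map_sub]; exact degree_sub_lt_of_coeff_eq hfD hiD hic.symm)
      refine ⟨f', d, ?_, h2, h3⟩
      have : f - f' = (f - i - f') + i := by ring
      rw [this]
      exact add_mem h1 hi
    · exact ⟨f, D, by simp, hfD, hc⟩

/-- An ideal whose ideal of leading forms is prime is itself prime. -/
theorem isPrime (hΦ : ∀ f, (Φ f).eval 1 = f)
    (hcoeff : ∀ f d, Φ ((Φ f).coeff d) = Polynomial.monomial d ((Φ f).coeff d))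
    (h : IsLeadingIdeal Φ I J) (hJ : J.IsPrime) : I.IsPrime := by
  refine ⟨fun hI => hJ.ne_top ?_, fun {f g} hfg => ?_⟩
  · rw [Ideal.eq_top_iff_one]
    simpa using h.coeff_mem 0 1 (by rw [hI]; trivial) (by simp)
  · by_contra! hcon
    obtain ⟨f', a, hf, hfa, hfJ⟩ := h.exists_sub_mem hΦ hcoeff hcon.1
    obtain ⟨g', b, hg, hgb, hgJ⟩ := h.exists_sub_mem hΦ hcoeff hcon.2
    have hmem : f' * g' ∈ I := by
      have : f' * g' = f * g - (f - f') * g - f' * (g - g') := by ring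
      rw [this]
      exact sub_mem (sub_mem hfg (Ideal.mul_mem_right _ _ hf)) (Ideal.mul_mem_left _ _ hg)
    have := h.coeff_mem (a + b) _ hmem (by
      rw [map_mul]; exact Polynomial.natDegree_mul_le_of_le hfa hgb)
    rw [map_mul, Polynomial.coeff_mul_add_eq_of_natDegree_le hfa hgb] at this
    exact (hJ.mem_or_mem this).elim hfJ hgJ

end IsLeadingIdeal

/-- Modulo `x y + u`, a power of `x` eliminates the variable `y`. -/
theorem exists_pow_mul_sub_mem_span {σ R : Type*} [CommRing R] (x y : σ) (hxy : x ≠ y)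
    {u : MvPolynomial σ R} (hu : u ∈ supported R ({y}ᶜ : Set σ)) (f : MvPolynomial σ R) :
    ∃ (d : ℕ) (f' : MvPolynomial σ R), f' ∈ supported R ({y}ᶜ : Set σ) ∧
      X x ^ d * f - f' ∈ Ideal.span {X x * X y + u} := by
  have hx : (X x : MvPolynomial σ R) ∈ supported R ({y}ᶜ : Set σ) :=
    Algebra.subset_adjoin ⟨x, by simpa using hxy, rfl⟩
  induction f using MvPolynomial.induction_on with
  | C a => exact ⟨0, C a, Subalgebra.algebraMap_mem _ a, by simp⟩
  | add f g hf hg =>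
    obtain ⟨a, f', hf', hf⟩ := hf
    obtain ⟨b, g', hg', hg⟩ := hg
    refine ⟨a + b, X x ^ b * f' + X x ^ a * g',
      add_mem (mul_mem (pow_mem hx _) hf') (mul_mem (pow_mem hx _) hg'), ?_⟩
    have : X x ^ (a + b) * (f + g) - (X x ^ b * f' + X x ^ a * g') =
      X x ^ b * (X x ^ a * f - f') + X x ^ a * (X x ^ b * g - g') := by ring
    rw [this]
    exact add_mem (Ideal.mul_mem_left _ _ hf) (Ideal.mul_mem_left _ _ hg)
  | mul_X f i hf =>
    obtain ⟨a, f', hf', hf⟩ := hf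
    by_cases hi : i = y
    · subst hi
      refine ⟨a + 1, - (f' * u), neg_mem (mul_mem hf' hu), ?_⟩
      have : X x ^ (a + 1) * (f * X i) - -(f' * u) =
        (X x * X i) * (X x ^ a * f - f') + f' * (X x * X i + u) := by ring
      rw [this]
      exact add_mem (Ideal.mul_mem_left _ _ hf)
        (Ideal.mul_mem_left _ _ (Ideal.mem_span_singleton_self _))
    · refine ⟨a, f' * X i, mul_mem hf' (Algebra.subset_adjoin ⟨i, by simpa using hi, rfl⟩), ?_⟩
      have : X x ^ a * (f * X i) - f' * X i = X i * (X x ^ a * f - f') := by ring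
      rw [this]
      exact Ideal.mul_mem_left _ _ hf

theorem algHom_eqOn_supported {σ R A : Type*} [CommRing R] [CommRing A] [Algebra R A] {s : Set σ}
    {φ ψ : MvPolynomial σ R →ₐ[R] A} (h : ∀ i ∈ s, φ (X i) = ψ (X i)) {f : MvPolynomial σ R}
    (hf : f ∈ supported R s) : φ f = ψ f := by
  have : supported R s ≤ AlgHom.equalizer φ ψ := by
    refine Algebra.adjoin_le ?_
    rintro _ ⟨i, hi, rfl⟩
    exact h i hi
  exact this hf

/-- Adjoining to a prime ideal a relation `x y + u` in two new variables. -/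
theorem isPrime_span_singleton_sup {σ k : Type*} [Field k] {x y : σ} (hxy : x ≠ y)
    {G : Set (MvPolynomial σ k)} {u : MvPolynomial σ k}
    (hG : ∀ g ∈ G, g ∈ supported k ({x, y}ᶜ : Set σ)) (hu : u ∈ supported k ({x, y}ᶜ : Set σ))
    (hprime : (Ideal.span G).IsPrime) (hx : X x ∉ Ideal.span G) (huG : u ∉ Ideal.span G) :
    (Ideal.span {X x * X y + u} ⊔ Ideal.span G).IsPrime := by
  classical
  set J := Ideal.span G with hJ
  set e := X x * X y + u with he
  have hsx : supported k ({x, y}ᶜ : Set σ) ≤ supported k ({x}ᶜ : Set σ) :=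
    supported_mono (by simp)
  have hsy : supported k ({x, y}ᶜ : Set σ) ≤ supported k ({y}ᶜ : Set σ) :=
    supported_mono (by simp)
  let ε : MvPolynomial σ k →ₐ[k] MvPolynomial σ k := aeval fun i => if i = x then 0 else X i
  have hε : ∀ f ∈ supported k ({x}ᶜ : Set σ), ε f = f := fun f hf =>
    algHom_eqOn_supported (ψ := AlgHom.id k _) (fun i hi => by
      have : i ≠ x := by simpa using hi
      simp [ε, this]) hf
  have hεx : ε (X x) = 0 := by simp [ε]
  have hεJ : ∀ f ∈ J, ε f ∈ J := by
    have : J ≤ J.comap ε := Ideal.span_le.2 fun g hg => by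
      change ε g ∈ J
      rw [hε g (hsx (hG g hg))]
      exact Ideal.subset_span hg
    exact fun f hf => this hf
  have hdiv : ∀ g, X x ∣ g - ε g := by
    intro g
    induction g using MvPolynomial.induction_on with
    | C a => simp [ε]
    | add f g hf hg => simpa [add_sub_add_comm] using dvd_add hf hg
    | mul_X f i hf =>
      have : f * X i - ε (f * X i) = (f - ε f) * X i + ε f * (X i - ε (X i)) := by
        rw [map_mul]; ring
      rw [this]
      refine dvd_add (hf.mul_right _) (Dvd.dvd.mul_left ?_ _)
      by_cases hi : i = x
      · simp [ε, hi]
      · simp [ε, hi]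
  have hnzd : ∀ f, X x * f ∈ Ideal.span {e} ⊔ J → f ∈ Ideal.span {e} ⊔ J := by
    intro f hf
    obtain ⟨g, j, hj, hgj⟩ := Ideal.mem_span_singleton_sup.1 hf
    obtain ⟨g', hg'⟩ := hdiv g
    have h1 : ε g * u ∈ J := by
      have h := congrArg ε hgj
      simp only [he, map_add, map_mul, hεx, hε u (hsx hu), zero_mul, zero_add] at h
      rw [eq_neg_of_add_eq_zero_left h]
      exact neg_mem (hεJ j hj)
    have h2 : ε g ∈ J := (hprime.mem_or_mem h1).resolve_right huG
    have h3 : X x * (f - g' * e) ∈ J := by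
      have : X x * (f - g' * e) = ε g * e + j := by
        rw [mul_sub, ← hgj]
        linear_combination e * hg'
      rw [this]
      exact add_mem (Ideal.mul_mem_right _ _ h2) hj
    have h4 := (hprime.mem_or_mem h3).resolve_left hx
    exact Ideal.mem_span_singleton_sup.2 ⟨g', _, h4, by ring⟩
  have hnzd_pow : ∀ (d : ℕ) f, X x ^ d * f ∈ Ideal.span {e} ⊔ J → f ∈ Ideal.span {e} ⊔ J := by
    intro d
    induction d with
    | zero => intro f hf; simpa using hf
    | succ d ih =>
      intro f hf
      exact ih f (hnzd _ (by rwa [pow_succ', mul_assoc] at hf))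
  let K := FractionRing (MvPolynomial σ k ⧸ J)
  let π : MvPolynomial σ k →ₐ[k] K :=
    (IsScalarTower.toAlgHom k (MvPolynomial σ k ⧸ J) K).comp (Ideal.Quotient.mkₐ k J)
  have hπ : ∀ f, π f = 0 ↔ f ∈ J := by
    intro f
    change algebraMap (MvPolynomial σ k ⧸ J) K (Ideal.Quotient.mk J f) = 0 ↔ _
    rw [FaithfulSMul.algebraMap_eq_zero_iff, Ideal.Quotient.eq_zero_iff_mem]
  let φ : MvPolynomial σ k →ₐ[k] K :=
    aeval fun i => if i = y then - π u / π (X x) else π (X i)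
  have hφ : ∀ f ∈ supported k ({y}ᶜ : Set σ), φ f = π f := fun f hf =>
    algHom_eqOn_supported (fun i hi => by
      have : i ≠ y := by simpa using hi
      simp [φ, this]) hf
  have hx0 : π (X x) ≠ 0 := fun h => hx ((hπ _).1 h)
  have hker : Ideal.span {e} ⊔ J = RingHom.ker φ := by
    have hle : Ideal.span {e} ≤ RingHom.ker φ := by
      rw [Ideal.span_singleton_le_iff_mem, RingHom.mem_ker, he, map_add, map_mul, hφ u (hsy hu)]
      simp only [φ, aeval_X, if_neg hxy, if_true]
      rw [mul_div_cancel₀ _ hx0, neg_add_cancel]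
    refine le_antisymm (sup_le hle (Ideal.span_le.2 fun g hg => ?_)) fun f hf => ?_
    · change φ g = 0
      rw [hφ g (hsy (hG g hg)), hπ]
      exact Ideal.subset_span hg
    · obtain ⟨d, f', hf', hd⟩ := exists_pow_mul_sub_mem_span x y hxy (hsy hu) f
      have h0 := hle hd
      rw [RingHom.mem_ker] at h0 hf
      rw [map_sub, map_mul, hf, mul_zero, zero_sub, neg_eq_zero, hφ f' hf', hπ] at h0
      apply hnzd_pow d
      have := add_mem (Ideal.mem_sup_left (S := _) (T := J) hd) (Ideal.mem_sup_right h0)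
      simpa using this
  rw [hker]
  exact RingHom.ker_isPrime φ

/-- The coaction on a polynomial ring sending `X i` to `T ^ w i * X i`; it encodes the grading
with weights `w`. -/
noncomputable def weightCoaction {σ : Type*} (k : Type*) [CommRing k] (w : σ → ℕ) :
    MvPolynomial σ k →+* Polynomial (MvPolynomial σ k) :=
  eval₂Hom (Polynomial.C.comp C) fun i => Polynomial.C (X i) * Polynomial.X ^ w i

section weightCoaction

variable {σ k : Type*} [CommRing k] (w : σ → ℕ)

@[simp]
theorem weightCoaction_C (a : k) : weightCoaction k w (C a) = Polynomial.C (C a) := by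
  simp [weightCoaction]

@[simp]
theorem weightCoaction_X (i : σ) :
    weightCoaction k w (X i) = Polynomial.C (X i) * Polynomial.X ^ w i := by
  simp [weightCoaction]

theorem eval_one_weightCoaction (f : MvPolynomial σ k) :
    (weightCoaction k w f).eval 1 = f := by
  induction f using MvPolynomial.induction_on with
  | C a => simp
  | add f g hf hg => simp [hf, hg]
  | mul_X f i hf => simp [hf]

theorem weightCoaction_coeff (f : MvPolynomial σ k) (d : ℕ) :
    weightCoaction k w ((weightCoaction k w f).coeff d) =
      Polynomial.monomial d ((weightCoaction k w f).coeff d) := by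
  induction f using MvPolynomial.induction_on generalizing d with
  | C a =>
    rw [weightCoaction_C, Polynomial.coeff_C]
    split_ifs with h
    · simp [h]
    · simp
  | add f g hf hg => simp [hf, hg]
  | mul_X f i hf =>
    rw [map_mul, weightCoaction_X, ← mul_assoc, Polynomial.coeff_mul_X_pow']
    split_ifs with h
    · rw [Polynomial.coeff_mul_C, map_mul, hf, weightCoaction_X,
        Polynomial.C_mul_X_pow_eq_monomial, Polynomial.monomial_mul_monomial, Nat.sub_add_cancel h]
    · simp

theorem weightCoaction_X_mul_X (i j : σ) :
    weightCoaction k w (X i * X j) = Polynomial.monomial (w i + w j) (X i * X j) := by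
  rw [map_mul, weightCoaction_X, weightCoaction_X, Polynomial.C_mul_X_pow_eq_monomial,
    Polynomial.C_mul_X_pow_eq_monomial, Polynomial.monomial_mul_monomial]

variable {κ : Type*} [Fintype κ] {w} {α β : κ → σ} {c : k} {δ : ℕ}

theorem natDegree_weightCoaction_sum_sub_le (hle : ∀ l, w (α l) + w (β l) ≤ δ) :
    (weightCoaction k w (∑ l, X (α l) * X (β l) - C c)).natDegree ≤ δ := by
  rw [map_sub, map_sum, weightCoaction_C]
  refine (Polynomial.natDegree_sub_le_of_le (Polynomial.natDegree_sum_le_of_forall_le _ _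
    fun l _ => ?_) (Polynomial.natDegree_C _).le).trans (by simp : max δ 0 ≤ δ)
  rw [weightCoaction_X_mul_X]
  exact (Polynomial.natDegree_monomial_le _).trans (hle l)

theorem coeff_weightCoaction_sum_sub [DecidableEq κ] {s t : κ} (hst : s ≠ t) (hδ : 0 < δ)
    (heq : ∀ l, w (α l) + w (β l) = δ ↔ l = s ∨ l = t) :
    (weightCoaction k w (∑ l, X (α l) * X (β l) - C c)).coeff δ =
      X (α s) * X (β s) + X (α t) * X (β t) := by
  rw [map_sub, map_sum, weightCoaction_C, Polynomial.coeff_sub, Polynomial.coeff_C,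
    if_neg hδ.ne', sub_zero, Polynomial.finsetSum_coeff]
  simp only [weightCoaction_X_mul_X, Polynomial.coeff_monomial, heq]
  rw [Fintype.sum_eq_add s t hst fun l hl => if_neg (by tauto)]
  simp

end weightCoaction

/-- If each generator has leading form `x y + u` with `x`, `y` not occurring in the
other leading forms of smaller or equal rank, then the ideal is prime. The nonvanishing conditions
are certified by the point `v`. -/
theorem isPrime_span_range_of_leadingForm {σ ι k : Type*} [Field k] [Fintype ι] (w : σ → ℕ)
    (E u : ι → MvPolynomial σ k) (x y : ι → σ) (δ rank : ι → ℕ) (v : σ → k)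
    (hxy : ∀ s, x s ≠ y s)
    (hdeg : ∀ s, (weightCoaction k w (E s)).natDegree ≤ δ s)
    (hlead : ∀ s, (weightCoaction k w (E s)).coeff (δ s) = X (x s) * X (y s) + u s)
    (hu : ∀ s, u s ∈ supported k ({x s, y s}ᶜ : Set σ))
    (hsupp : ∀ s t, t ≠ s → rank t ≤ rank s →
      X (x t) * X (y t) + u t ∈ supported k ({x s, y s}ᶜ : Set σ))
    (hv : ∀ s, aeval v (X (x s) * X (y s) + u s) = 0) (hvx : ∀ s, v (x s) ≠ 0)
    (hvu : ∀ s, aeval v (u s) ≠ 0) :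
    (Ideal.span (Set.range E)).IsPrime := by
  classical
  set e : ι → MvPolynomial σ k := fun s => X (x s) * X (y s) + u s with he
  have key : ∀ T : Finset ι,
      IsLeadingIdeal (weightCoaction k w) (Ideal.span (E '' T)) (Ideal.span (e '' T)) ∧
        (Ideal.span (e '' (T : Set ι))).IsPrime := by
    intro T
    induction T using Finset.induction_on_max_value rank with
    | empty => simpa using ⟨IsLeadingIdeal.bot, Ideal.isPrime_bot⟩
    | insert s T hs hT ih =>
      have hsT : ∀ g ∈ e '' (T : Set ι), g ∈ supported k ({x s, y s}ᶜ : Set σ) := by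
        rintro _ ⟨t, ht, rfl⟩
        exact hsupp s t (fun h => hs (h ▸ ht)) (hT t ht)
      have hker : Ideal.span (e '' (T : Set ι)) ≤ RingHom.ker (aeval (R := k) v) := by
        rw [Ideal.span_le]
        rintro _ ⟨t, -, rfl⟩
        exact hv t
      have hv' : ∀ f ∈ supported k ({x s, y s}ᶜ : Set σ),
          aeval (Function.update v (x s) 0) f = aeval v f := fun f hf =>
        algHom_eqOn_supported (fun i hi => by
          have : i ≠ x s := by rintro rfl; simp at hi
          simp [this]) hf
      have hker' : Ideal.span (e '' (T : Set ι)) ≤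
          RingHom.ker (aeval (R := k) (Function.update v (x s) 0)) := by
        rw [Ideal.span_le]
        rintro _ ⟨t, ht, rfl⟩
        change aeval _ _ = _
        rw [hv' _ (hsT _ ⟨t, ht, rfl⟩)]
        exact hv t
      have hes : e s ∉ Ideal.span (e '' (T : Set ι)) := fun h => hvu s <| by
        have := hker' h
        change aeval _ (X (x s) * X (y s) + u s) = 0 at this
        simpa only [map_add, map_mul, aeval_X, Function.update_self, zero_mul, zero_add,
          hv' _ (hu s)] using this
      rw [Finset.coe_insert, Set.image_insert_eq, Set.image_insert_eq, Ideal.span_insert,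
        Ideal.span_insert]
      refine ⟨ih.1.sup_span_singleton (eval_one_weightCoaction w) (weightCoaction_coeff w) ih.2
        (hdeg s) (hlead s) hes, isPrime_span_singleton_sup (hxy s) hsT (hu s) ih.2
          (fun h => hvx s ?_) fun h => hvu s (hker h)⟩
      simpa using hker h
  have h := key Finset.univ
  rw [Finset.coe_univ, Set.image_univ] at h
  exact h.1.isPrime (eval_one_weightCoaction w) (weightCoaction_coeff w) h.2

/-- The weight inequality `(k - s) (k - s - 1) ≥ 0`, with its equality cases. -/
theorem weight_le_and_eq_iff {P k i j : ℕ} (hk : k < P) :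
    P ^ 2 + k + 2 * k * i - k ^ 2 + 2 * k * j ≤ P ^ 2 + (i + j) * (i + j + 1) ∧
      (P ^ 2 + k + 2 * k * i - k ^ 2 + 2 * k * j = P ^ 2 + (i + j) * (i + j + 1) ↔
        k = i + j ∨ k = i + j + 1) := by
  have hkP : k ^ 2 ≤ P ^ 2 + k + 2 * k * i := by nlinarith
  zify [hkP]
  have hnn : (0 : ℤ) ≤ ((k : ℤ) - (i + j)) * (k - (i + j + 1)) := by
    rcases le_or_gt k (i + j) with h | h
    · exact mul_nonneg_of_nonpos_of_nonpos (by lia) (by lia)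
    · exact mul_nonneg (by lia) (by lia)
  refine ⟨by linarith, fun h => ?_, ?_⟩
  · have : ((k : ℤ) - (i + j)) * (k - (i + j + 1)) = 0 := by linarith
    rcases mul_eq_zero.1 this with h | h
    · left; lia
    · right; lia
  · rintro (h | h) <;> rw [h] <;> ring

/-- Indices of the matrix entries of `A`, `B`, `C`, `D`. -/
abbrev MomentVar (p q m n : ℕ) : Type :=
  ((Fin p × Fin m) ⊕ (Fin p × Fin n)) ⊕ ((Fin q × Fin m) ⊕ (Fin q × Fin n))

/-- Indices of the entries of `AᵀB` and `DᵀC`. -/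
abbrev MomentEq (m n : ℕ) : Type := (Fin m × Fin n) ⊕ (Fin n × Fin m)

/-- For the dual pair `(U(p,q), U(m,n))` in the stable range `m + n ≤ min(p,q)`,
the scheme-theoretic fiber of the moment map `ψ(A,B,C,D) = (AᵀB, DᵀC)` over any
point `(X,Y)` is reduced and irreducible: the quotient of the polynomial ring by
the fiber ideal is an integral domain. -/
theorem momentFiberUU_isDomain (p q m n : ℕ) (hp : 0 < p) (hq : 0 < q)
    (hm : 0 < m) (hn : 0 < n) (h1 : m + n ≤ p) (h2 : m + n ≤ q)
    (Xm : Matrix (Fin m) (Fin n) ℂ) (Ym : Matrix (Fin n) (Fin m) ℂ) :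
    IsDomain (MvPolynomial
        (((Fin p × Fin m) ⊕ (Fin p × Fin n)) ⊕ ((Fin q × Fin m) ⊕ (Fin q × Fin n))) ℂ ⧸
      momentFiberIdealUU p q m n Xm Ym) := by
  let w : MomentVar p q m n → ℕ := Sum.elim
    (Sum.elim (fun a => p ^ 2 + a.1 + 2 * a.1 * a.2 - (a.1 : ℕ) ^ 2) fun b => 2 * b.1 * b.2)
    (Sum.elim (fun c => 2 * c.1 * c.2) fun d => q ^ 2 + d.1 + 2 * d.1 * d.2 - (d.1 : ℕ) ^ 2)
  let v : MomentVar p q m n → ℂ := Sum.elim (Sum.elim (fun _ => 1) fun b => (-1) ^ (b.1 : ℕ))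
    (Sum.elim (fun c => (-1) ^ (c.1 : ℕ)) fun _ => 1)
  let E : MomentEq m n → MvPolynomial (MomentVar p q m n) ℂ := Sum.elim
    (fun s => (∑ k : Fin p, X (Sum.inl (Sum.inl (k, s.1))) * X (Sum.inl (Sum.inr (k, s.2)))) -
      C (Xm s.1 s.2))
    (fun s => (∑ l : Fin q, X (Sum.inr (Sum.inr (l, s.1))) * X (Sum.inr (Sum.inl (l, s.2)))) -
      C (Ym s.1 s.2))
  let lp (i : Fin m) (j : Fin n) : Fin p := ⟨i + j, by lia⟩
  let lp' (i : Fin m) (j : Fin n) : Fin p := ⟨i + j + 1, by lia⟩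
  let lq (i : Fin n) (j : Fin m) : Fin q := ⟨i + j, by lia⟩
  let lq' (i : Fin n) (j : Fin m) : Fin q := ⟨i + j + 1, by lia⟩
  let x : MomentEq m n → MomentVar p q m n := Sum.elim (fun s => Sum.inl (Sum.inl (lp' s.1 s.2, s.1)))
    fun s => Sum.inr (Sum.inr (lq' s.1 s.2, s.1))
  let y : MomentEq m n → MomentVar p q m n := Sum.elim (fun s => Sum.inl (Sum.inr (lp' s.1 s.2, s.2)))
    fun s => Sum.inr (Sum.inl (lq' s.1 s.2, s.2))
  let u : MomentEq m n → MvPolynomial (MomentVar p q m n) ℂ := Sum.elim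
    (fun s => X (Sum.inl (Sum.inl (lp s.1 s.2, s.1))) * X (Sum.inl (Sum.inr (lp s.1 s.2, s.2))))
    fun s => X (Sum.inr (Sum.inr (lq s.1 s.2, s.1))) * X (Sum.inr (Sum.inl (lq s.1 s.2, s.2)))
  let rank : MomentEq m n → ℕ := Sum.elim (fun s => s.1 + s.2) fun s => s.1 + s.2
  let δ : MomentEq m n → ℕ := Sum.elim (fun s => p ^ 2 + (s.1 + s.2) * (s.1 + s.2 + 1))
    fun s => q ^ 2 + (s.1 + s.2) * (s.1 + s.2 + 1)
  have hspan : momentFiberIdealUU p q m n Xm Ym = Ideal.span (Set.range E) := by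
    rw [Set.Sum.elim_range]
    unfold momentFiberIdealUU
    congr 2 <;> ext f <;> simp [eq_comm]
  have hprime : (Ideal.span (Set.range E)).IsPrime := by
    refine isPrime_span_range_of_leadingForm w E u x y δ rank v ?_ ?_ ?_ ?_ ?_ ?_ ?_ ?_
    · rintro (s | s) <;> simp [x, y]
    · rintro (⟨i, j⟩ | ⟨i, j⟩) <;>
        exact natDegree_weightCoaction_sum_sub_le fun l => (weight_le_and_eq_iff l.2).1
    · rintro (⟨i, j⟩ | ⟨i, j⟩)
      · exact coeff_weightCoaction_sum_sub (s := lp' i j) (t := lp i j) (by simp [lp, lp'])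
          (Nat.add_pos_left (pow_pos hp 2) _) fun l => (weight_le_and_eq_iff l.2).2.trans <| by
            simp [lp, lp', Fin.ext_iff, or_comm]
      · exact coeff_weightCoaction_sum_sub (s := lq' i j) (t := lq i j) (by simp [lq, lq'])
          (Nat.add_pos_left (pow_pos hq 2) _) fun l => (weight_le_and_eq_iff l.2).2.trans <| by
            simp [lq, lq', Fin.ext_iff, or_comm]
    · rintro (⟨i, j⟩ | ⟨i, j⟩) <;> refine mul_mem ?_ ?_ <;> rw [X_mem_supported] <;>
        simp [x, y, lp, lp', lq, lq']
    · rintro (⟨i, j⟩ | ⟨i, j⟩) (⟨i', j'⟩ | ⟨i', j'⟩) hne hr <;>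
        refine add_mem (mul_mem ?_ ?_) (mul_mem ?_ ?_) <;> rw [X_mem_supported] <;>
        simp [x, y, lp, lp', lq, lq', rank, Fin.ext_iff] at hne hr ⊢ <;> lia
    · rintro (⟨i, j⟩ | ⟨i, j⟩) <;> simp [x, y, u, v, lp, lp', lq, lq', pow_succ]
    · rintro (⟨i, j⟩ | ⟨i, j⟩) <;> simp [x, v]
    · rintro (⟨i, j⟩ | ⟨i, j⟩) <;> simp [u, v]
  rw [hspan]
  exact Ideal.Quotient.isDomain _
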